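/- arXiv:0802.0264 — 3 statements merged into one kernel-verified Lean document; each statement's English description precedes it below -/
import Mathlib

section
/- Let q < 3 and β > 0, and set g_q(β, ξ) := F_q[G_q(β;·)](ξ). Then for all ξ ∈ ℝ: (1) g_q(β, ξ) = g_q(1, ξ·β^{-(2-q)/2}); (2) g_q(1, ξ) = C_q^{-1}·Y(q, C_q^{1-q}·ξ). Consequently F_q[G_q(β;·)](ξ) = C_q^{-1}·Y(q, (C_q/√β)^{1-q}·ξ/√β). -/
open MeasureTheory Complex Real Set Filter

noncomputable section

/-- The complex `q`-exponential: principal branch of `(1+(1-q)z)^{1/(1-q)}`,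
set to `0` when `1+(1-q)z` is a nonpositive real; `exp z` for `q = 1`. -/
def qExp (q : ℝ) (z : ℂ) : ℂ :=
  if q = 1 then Complex.exp z
  else if (1 + (1 - q) * z).im = 0 ∧ (1 + (1 - q) * z).re ≤ 0 then 0
  else (1 + (1 - q) * z) ^ ((1 : ℂ) / (1 - q))

/-- The real `q`-exponential: `(1+(1-q)z)^{1/(1-q)}` when `1+(1-q)z > 0`,
`0` when `1+(1-q)z ≤ 0`; `exp z` for `q = 1`. -/
def qExpR (q z : ℝ) : ℝ :=
  if q = 1 then Real.exp z
  else if 1 + (1 - q) * z ≤ 0 then 0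
  else (1 + (1 - q) * z) ^ ((1 : ℝ) / (1 - q))

/-- The `q`-Fourier transform of a nonnegative function `f` on `ℝ`:
`F_q[f](ξ) = ∫_{{x : f x > 0}} f(x) · e_q^{i x ξ f(x)^{q-1}} dx`. -/
def qFourier (q : ℝ) (f : ℝ → ℝ) (ξ : ℝ) : ℂ :=
  ∫ x in {x : ℝ | 0 < f x},
    (f x : ℂ) * qExp q (Complex.I * (x : ℂ) * (ξ : ℂ) * ((f x ^ (q - 1) : ℝ) : ℂ))

/-- The normalizing constant `C_q = ∫_ℝ e_q^{-x²} dx`. -/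
def Cq (q : ℝ) : ℝ := ∫ x : ℝ, qExpR q (-x ^ 2)

/-- The `q`-Gaussian `G_q(β; x) = (√β / C_q) e_q^{-β x²}`. -/
def qGaussian (q β x : ℝ) : ℝ := (Real.sqrt β / Cq q) * qExpR q (-β * x ^ 2)

/-- `Y(q,ξ) = ∫_{-K}^{K} e_q^{-x² + i x ξ} dx`, with `K = (1-q)^{-1/2}` if `q < 1`
and the integral over all of `ℝ` if `q ≥ 1`. -/
def Yfun (q ξ : ℝ) : ℂ :=
  if q < 1 then
    ∫ x in Set.Ioo (-((1 - q) ^ (-(1 : ℝ) / 2))) ((1 - q) ^ (-(1 : ℝ) / 2)),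
      qExp q (-(x : ℂ) ^ 2 + Complex.I * (x : ℂ) * (ξ : ℂ))
  else ∫ x : ℝ, qExp q (-(x : ℂ) ^ 2 + Complex.I * (x : ℂ) * (ξ : ℂ))

theorem qExpR_nonneg (q y : ℝ) : 0 ≤ qExpR q y := by
  unfold qExpR
  split_ifs with h₁ h₂
  · positivity
  · exact le_rfl
  · exact Real.rpow_nonneg (not_le.mp h₂).le _

theorem qExpR_pos_iff {q y : ℝ} : 0 < qExpR q y ↔ 0 < 1 + (1 - q) * y := by
  unfold qExpR
  split_ifs with h₁ h₂
  · simp [h₁, Real.exp_pos]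
  · simpa using h₂
  · exact iff_of_true (Real.rpow_pos_of_pos (not_le.mp h₂) _) (not_le.mp h₂)

theorem Cq_nonneg (q : ℝ) : 0 ≤ Cq q :=
  integral_nonneg fun _ => qExpR_nonneg _ _

/-- The product rule for `q`-exponentials that makes the `q`-Fourier transform computable:
`e_q^y · e_q^{i t (e_q^y)^{q-1}} = e_q^{y + i t}` where `e_q^y > 0`. -/
theorem qExpR_mul_qExp {q y : ℝ} (hy : 0 < qExpR q y) (t : ℝ) :
    (qExpR q y : ℂ) * qExp q (I * t * ((qExpR q y ^ (q - 1) : ℝ) : ℂ)) = qExp q (y + I * t) := by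
  have ha := qExpR_pos_iff.mp hy
  by_cases h : q = 1
  · simp [qExp, qExpR, h, Complex.exp_add]
  have hq : 1 - q ≠ 0 := sub_ne_zero.mpr (Ne.symm h)
  set a := 1 + (1 - q) * y with ha_def
  have hE : qExpR q y = a ^ (1 / (1 - q)) := by
    rw [qExpR, if_neg h, if_neg ha.not_ge]
  have hEpow : qExpR q y ^ (q - 1) = a⁻¹ := by
    rw [hE, ← Real.rpow_mul ha.le, show 1 / (1 - q) * (q - 1) = -1 by field_simp; ring,
      Real.rpow_neg_one]
  have haC : (a : ℂ) ≠ 0 := ofReal_ne_zero.mpr ha.ne'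
  set w : ℂ := 1 + (1 - q) * (I * t * ((a⁻¹ : ℝ) : ℂ)) with hw
  have hw_eq : w = 1 + (((1 - q) * (t * a⁻¹) : ℝ) : ℂ) * I := by
    rw [hw]; push_cast; ring
  have hw_re : w.re = 1 := by simp [hw_eq]
  have hw_ne : w ≠ 0 := fun h0 => by simp [h0] at hw_re
  have hmul : 1 + (1 - q) * ((y : ℂ) + I * t) = a * w := by
    have hac : (a : ℂ) = 1 + (1 - q) * y := by rw [ha_def]; push_cast; ring
    have hinv : (a : ℂ) * (a : ℂ)⁻¹ = 1 := mul_inv_cancel₀ haC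
    rw [hw]
    push_cast
    linear_combination -hac - (1 - q) * I * t * hinv
  rw [hEpow, hE, qExp, qExp, if_neg h, if_neg h, hmul, ← hw, if_neg, if_neg, ofReal_cpow ha.le,
    cpow_def_of_ne_zero haC, cpow_def_of_ne_zero hw_ne,
    cpow_def_of_ne_zero (mul_ne_zero haC hw_ne), log_ofReal_mul ha hw_ne, ← Complex.exp_add,
    ofReal_log ha.le]
  · congr 1
    push_cast
    ring
  · rintro ⟨-, h0⟩
    rw [re_ofReal_mul, hw_re, mul_one] at h0
    exact h0.not_gt ha
  · rintro ⟨-, h0⟩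
    rw [hw_re] at h0
    exact h0.not_gt one_pos

theorem qFourier_const_mul (q : ℝ) {f : ℝ → ℝ} (hf : ∀ x, 0 ≤ f x) {c : ℝ} (hc : 0 < c) (ξ : ℝ) :
    qFourier q (fun x => c * f x) ξ = c * qFourier q f (c ^ (q - 1) * ξ) := by
  simp only [qFourier, mul_pos_iff_of_pos_left hc]
  rw [← integral_const_mul]
  congr 1 with x
  rw [Real.mul_rpow hc.le (hf x)]
  push_cast
  ring_nf

open scoped Pointwise in
theorem qFourier_comp_mul_left (q : ℝ) (f : ℝ → ℝ) {c : ℝ} (hc : 0 < c) (ξ : ℝ) :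
    qFourier q (fun x => f (c * x)) ξ = ((c⁻¹ : ℝ) : ℂ) * qFourier q f (ξ / c) := by
  have hset : c • {x : ℝ | 0 < f (c * x)} = {x : ℝ | 0 < f x} := by
    ext x
    simp [Set.mem_smul_set_iff_inv_smul_mem₀ hc.ne', mul_inv_cancel_left₀ hc.ne']
  have hcC : (c : ℂ) ≠ 0 := ofReal_ne_zero.mpr hc.ne'
  have key := Measure.setIntegral_comp_smul_of_pos volume
    (fun x : ℝ => (f x : ℂ) * qExp q (I * x * ((ξ / c : ℝ) : ℂ) * ((f x ^ (q - 1) : ℝ) : ℂ)))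
    {x : ℝ | 0 < f (c * x)} hc
  rw [hset, Module.finrank_self, pow_one, real_smul] at key
  rw [qFourier, qFourier, ← key]
  congr 1 with x
  simp only [smul_eq_mul]
  congr 2
  push_cast
  field_simp

/-- `Y(q, ·)` is the `q`-Fourier transform of `x ↦ e_q^{-x²}`. -/
theorem qFourier_qExpR_neg_sq (q ξ : ℝ) : qFourier q (fun x => qExpR q (-x ^ 2)) ξ = Yfun q ξ := by
  have hset : MeasurableSet {x : ℝ | 0 < qExpR q (-x ^ 2)} := by
    simp only [qExpR_pos_iff]
    exact measurableSet_lt (by fun_prop) (by fun_prop)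
  have hint : qFourier q (fun x => qExpR q (-x ^ 2)) ξ =
      ∫ x in {x : ℝ | 0 < qExpR q (-x ^ 2)}, qExp q (-(x : ℂ) ^ 2 + I * x * ξ) := by
    refine setIntegral_congr_fun hset fun x hx => ?_
    have := qExpR_mul_qExp hx (x * ξ)
    push_cast at this
    simpa only [mul_assoc, ofReal_mul] using this
  rw [hint, Yfun]
  split_ifs with h
  · congr 2
    have hq : 0 < 1 - q := sub_pos.mpr h
    ext x
    have hK : (1 - q) ^ (-(1 : ℝ) / 2) = √((1 - q)⁻¹) := by
      rw [Real.sqrt_eq_rpow, Real.inv_rpow hq.le, ← Real.rpow_neg hq.le, neg_div]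
    rw [Set.mem_ofPred_eq, qExpR_pos_iff, hK, Set.mem_Ioo, ← Real.sq_lt, inv_eq_one_div,
      lt_div_iff₀' hq, mul_neg, ← sub_eq_add_neg, sub_pos]
  · have huniv : {x : ℝ | 0 < qExpR q (-x ^ 2)} = Set.univ := by
      refine Set.eq_univ_of_forall fun x => qExpR_pos_iff.mpr ?_
      nlinarith [mul_nonneg (sub_nonneg.mpr (not_lt.mp h)) (sq_nonneg x)]
    rw [huniv, setIntegral_univ]

theorem qFourier_qGaussian (q : ℝ) {β : ℝ} (hβ : 0 < β) (ξ : ℝ) :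
    qFourier q (qGaussian q β) ξ =
      ((1 / Cq q : ℝ) : ℂ) * Yfun q ((Cq q / √β) ^ (1 - q) * ξ / √β) := by
  rcases (Cq_nonneg q).eq_or_lt with hC | hC
  · simp [qFourier, qGaussian, ← hC]
  have hs : 0 < √β := Real.sqrt_pos.mpr hβ
  have hG : qGaussian q β = fun x => √β / Cq q * qExpR q (-(√β * x) ^ 2) := by
    ext x
    rw [qGaussian, mul_pow, Real.sq_sqrt hβ.le, neg_mul]
  have hpow : (√β / Cq q) ^ (q - 1) = (Cq q / √β) ^ (1 - q) := by
    rw [← inv_div, Real.inv_rpow (by positivity), ← Real.rpow_neg (by positivity), neg_sub]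
  rw [hG, qFourier_const_mul q (fun _ => qExpR_nonneg _ _) (div_pos hs hC),
    qFourier_comp_mul_left q (fun x => qExpR q (-x ^ 2)) hs, qFourier_qExpR_neg_sq, hpow,
    ← mul_assoc, ← ofReal_mul]
  congr 2
  field_simp

/-- scaling relations for `g_q(β,ξ) := F_q[G_q(β;·)](ξ)` in terms of
`g_q(1,·)` and `Y(q,·)`. -/
theorem qFourier_qGaussian_scaling (q : ℝ) (hq : q < 3) (β : ℝ) (hβ : 0 < β) (ξ : ℝ) :
    (qFourier q (qGaussian q β) ξ = qFourier q (qGaussian q 1) (ξ * β ^ (-(2 - q) / 2))) ∧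
    (qFourier q (qGaussian q 1) ξ = ((1 / Cq q : ℝ) : ℂ) * Yfun q (Cq q ^ (1 - q) * ξ)) ∧
    (qFourier q (qGaussian q β) ξ =
      ((1 / Cq q : ℝ) : ℂ) *
        Yfun q ((Cq q / Real.sqrt β) ^ (1 - q) * ξ / Real.sqrt β)) := by
  have hone : qFourier q (qGaussian q 1) = fun η =>
      ((1 / Cq q : ℝ) : ℂ) * Yfun q (Cq q ^ (1 - q) * η) := by
    ext η
    simpa using qFourier_qGaussian q one_pos η
  refine ⟨?_, congrFun hone ξ, qFourier_qGaussian q hβ ξ⟩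
  have hs : 0 < √β := Real.sqrt_pos.mpr hβ
  have hpow : β ^ (-(2 - q) / 2) = (√β ^ (1 - q) * √β)⁻¹ := by
    rw [← Real.rpow_add_one hs.ne', ← Real.rpow_neg hs.le, Real.sqrt_eq_rpow,
      ← Real.rpow_mul hβ.le]
    ring_nf
  rw [qFourier_qGaussian q hβ, hone, hpow, Real.div_rpow (Cq_nonneg q) hs.le]
  congr 2
  field_simp

end
end

section
/- Let m be a positive integer and q = (2m−1)/(2m). Then ξ ↦ Y(q,ξ) is differentiable (indeed a polynomial of degree 2m) and satisfies the homogeneous functional-differential equation 2√q·∂_ξ Y(q,ξ) + ξ·Y(2 − 1/q, √q·ξ) = 0 for every ξ ∈ ℝ, where 2 − 1/q = (2m−2)/(2m−1). -/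
open MeasureTheory Complex Real Set Filter

noncomputable section

/-- For `q = 1 - 1/n` the integrand defining `Yfun q` is an honest `n`-th power. -/
lemma Yfun_eq_intervalIntegral {n : ℕ} (hn : 0 < n) {q : ℝ} (hq : 1 - q = 1 / (n : ℝ)) (ξ : ℝ) :
    Yfun q ξ = ∫ x in (-√(n : ℝ))..√(n : ℝ),
      (1 + (-(x : ℂ) ^ 2 + I * x * ξ) / n) ^ n := by
  have hnR : (0 : ℝ) < n := by exact_mod_cast hn
  have hpos : 0 < 1 - q := by rw [hq]; positivity
  have hK : (1 - q) ^ (-(1 : ℝ) / 2) = √(n : ℝ) := by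
    rw [hq, one_div, neg_div, Real.rpow_neg (by positivity), Real.inv_rpow hnR.le, inv_inv,
      Real.sqrt_eq_rpow]
  have hqC : (1 : ℂ) - (q : ℂ) = 1 / (n : ℂ) := by
    simpa using congrArg (fun t : ℝ => (t : ℂ)) hq
  rw [Yfun, if_pos (by linarith), hK, intervalIntegral.integral_of_le
    (by linarith [Real.sqrt_nonneg (n : ℝ)]), integral_Ioc_eq_integral_Ioo]
  refine setIntegral_congr_fun measurableSet_Ioo fun x hx => ?_
  have hx2 : x ^ 2 < n := by
    have := sq_lt_sq' hx.1 hx.2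
    rwa [Real.sq_sqrt hnR.le] at this
  have hre : 0 < (1 + (-(x : ℂ) ^ 2 + I * x * ξ) / n).re := by
    have : (1 + (-(x : ℂ) ^ 2 + I * x * ξ) / n) =
        ((1 - x ^ 2 / n : ℝ) : ℂ) + ((x * ξ / n : ℝ) : ℂ) * I := by
      push_cast; ring
    rw [this, Complex.add_re, Complex.ofReal_re, Complex.re_ofReal_mul, Complex.I_re, mul_zero,
      add_zero, sub_pos, div_lt_one hnR]
    exact hx2
  have hbase : 1 + (1 - (q : ℂ)) * (-(x : ℂ) ^ 2 + I * x * ξ) =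
      1 + (-(x : ℂ) ^ 2 + I * x * ξ) / n := by
    rw [hqC]; ring
  simp only [qExp]
  rw [if_neg (by linarith), hbase, if_neg (fun h => absurd h.2 (not_le.mpr hre)), hqC,
    one_div_one_div, Complex.cpow_natCast]

lemma hasDerivAt_intervalIntegral_add_mul_pow (a b : ℝ → ℂ) (ha : Continuous a) (hb : Continuous b)
    (r s : ℝ) (n : ℕ) (ξ : ℝ) :
    HasDerivAt (fun ξ : ℝ => ∫ x in r..s, (a x + b x * ξ) ^ n)
      (∫ x in r..s, n * (a x + b x * ξ) ^ (n - 1) * b x) ξ := by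
  refine (intervalIntegral.hasDerivAt_integral_of_dominated_loc_of_deriv_le
    (F := fun (ξ : ℝ) x => (a x + b x * ξ) ^ n)
    (F' := fun (ξ : ℝ) x => n * (a x + b x * ξ) ^ (n - 1) * b x)
    (bound := fun x => n * (‖a x‖ + ‖b x‖ * (|ξ| + 1)) ^ (n - 1) * ‖b x‖)
    (Metric.ball_mem_nhds ξ one_pos) ?_ ?_ ?_ ?_ ?_ ?_).2
  · exact Eventually.of_forall fun y => by fun_prop
  · exact Continuous.intervalIntegrable (by fun_prop) _ _
  · fun_prop
  · refine Eventually.of_forall fun x _ y hy => ?_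
    have hy' : ‖(y : ℂ)‖ ≤ |ξ| + 1 := by
      rw [Complex.norm_real, Real.norm_eq_abs]
      rw [Metric.mem_ball, Real.dist_eq] at hy
      have := abs_sub_abs_le_abs_sub y ξ
      linarith
    have hsum : ‖a x + b x * y‖ ≤ ‖a x‖ + ‖b x‖ * (|ξ| + 1) := by
      refine (norm_add_le _ _).trans ?_
      rw [norm_mul]
      gcongr
    rw [norm_mul, norm_mul, norm_pow, Complex.norm_natCast]
    gcongr
  · exact Continuous.intervalIntegrable (by fun_prop) _ _
  · refine Eventually.of_forall fun x _ y _ => ?_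
    have h : HasDerivAt (fun y : ℝ => a x + b x * (y : ℂ)) (b x) y := by
      simpa using ((Complex.ofRealCLM.hasDerivAt (x := y)).const_mul (b x)).const_add (a x)
    exact h.pow n

/-- The integral of `(a + b ξ) ^ n` is a polynomial in `ξ`, of degree `n` as soon as its leading
coefficient `∫ b ^ n` does not vanish. -/
lemma exists_polynomial_intervalIntegral_add_mul_pow (a b : ℝ → ℂ) (ha : Continuous a)
    (hb : Continuous b) (r s : ℝ) (n : ℕ) (h : ∫ x in r..s, b x ^ n ≠ 0) :
    ∃ P : Polynomial ℂ, P.natDegree = n ∧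
      ∀ ξ : ℂ, ∫ x in r..s, (a x + b x * ξ) ^ n = P.eval ξ := by
  refine ⟨∑ k ∈ Finset.range (n + 1), Polynomial.monomial k
    (∫ x in r..s, b x ^ k * a x ^ (n - k) * (n.choose k : ℂ)), ?_, fun ξ => ?_⟩
  · refine Polynomial.natDegree_eq_of_le_of_coeff_ne_zero ?_ ?_
    · refine Polynomial.natDegree_sum_le_of_forall_le _ _ fun k hk => ?_
      exact (Polynomial.natDegree_monomial_le _).trans (Finset.mem_range_succ_iff.mp hk)
    · simpa [Polynomial.finsetSum_coeff, Polynomial.coeff_monomial] using h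
  · simp only [Polynomial.eval_finsetSum, Polynomial.eval_monomial,
      ← intervalIntegral.integral_mul_const]
    rw [← intervalIntegral.integral_finsetSum
      fun k _ => Continuous.intervalIntegrable (by fun_prop) _ _]
    refine intervalIntegral.integral_congr fun x _ => ?_
    simp only [add_comm (a x), add_pow]
    refine Finset.sum_congr rfl fun k _ => ?_
    ring

lemma integral_pow_symm_ne_zero {n : ℕ} (hn : 0 < n) (hev : Even n) {K : ℝ} (hK : 0 < K) :
    ∫ x in (-K)..K, (I * (x : ℂ) / n) ^ n ≠ 0 := by
  have hn0 : (n : ℂ) ≠ 0 := by exact_mod_cast hn.ne'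
  have h : ∀ x : ℝ, (I * (x : ℂ) / n) ^ n = (I / n) ^ n * ((x ^ n : ℝ) : ℂ) := fun x => by
    push_cast; rw [← mul_pow]; ring
  simp only [h]
  rw [intervalIntegral.integral_const_mul, intervalIntegral.integral_ofReal, integral_pow,
    hev.add_one.neg_pow, sub_neg_eq_add]
  refine mul_ne_zero (pow_ne_zero _ (div_ne_zero I_ne_zero hn0)) ?_
  rw [Complex.ofReal_ne_zero]
  positivity

/-- Integration by parts identity: the boundary terms cancel for even `n`. -/
lemma integral_deriv_pow_eq_zero {n : ℕ} (hn : 0 < n) (hev : Even n) (ξ : ℝ) :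
    ∫ x in (-√(n : ℝ))..√(n : ℝ),
      (1 + (-(x : ℂ) ^ 2 + I * x * ξ) / n) ^ (n - 1) * (-2 * x + I * ξ) = 0 := by
  have hn0 : (n : ℂ) ≠ 0 := by exact_mod_cast hn.ne'
  have hderiv : ∀ x : ℝ, HasDerivAt (fun x : ℝ => (1 + (-(x : ℂ) ^ 2 + I * x * ξ) / n) ^ n)
      ((1 + (-(x : ℂ) ^ 2 + I * x * ξ) / n) ^ (n - 1) * (-2 * x + I * ξ)) x := fun x => by
    have hx : HasDerivAt (fun x : ℝ => (x : ℂ)) 1 x := Complex.ofRealCLM.hasDerivAt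
    have h := ((((hx.pow 2).neg.add ((hx.const_mul I).mul_const (ξ : ℂ))).div_const
      (n : ℂ)).const_add 1).pow n
    refine h.congr_deriv ?_
    simp
    field_simp
  rw [intervalIntegral.integral_eq_sub_of_hasDerivAt (fun x _ => hderiv x)
    (Continuous.intervalIntegrable (by fun_prop) _ _)]
  have hs : ((√(n : ℝ) : ℝ) : ℂ) ^ 2 = n := by
    rw [← Complex.ofReal_pow, Real.sq_sqrt (Nat.cast_nonneg n)]; simp
  have h1 : (1 + (-(((-√(n : ℝ) : ℝ)) : ℂ) ^ 2 + I * ((-√(n : ℝ) : ℝ) : ℂ) * ξ) / n) =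
      -(1 + (-((√(n : ℝ) : ℝ) : ℂ) ^ 2 + I * ((√(n : ℝ) : ℝ) : ℂ) * ξ) / n) := by
    push_cast
    rw [neg_sq, hs]
    field_simp
    ring
  rw [h1, hev.neg_pow, sub_self]

/-- Rescaling the variable relates the exponents `n` and `n + 1`. -/
lemma integral_rescale {n : ℕ} (hn : 0 < n) {q : ℝ} (hq : q = n / (n + 1 : ℝ)) (ξ : ℝ) :
    ∫ x in (-√(n : ℝ))..√(n : ℝ), (1 + (-(x : ℂ) ^ 2 + I * x * ((√q * ξ : ℝ) : ℂ)) / n) ^ n =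
      (√q : ℂ) * ∫ x in (-√((n + 1 : ℕ) : ℝ))..√((n + 1 : ℕ) : ℝ),
        (1 + (-(x : ℂ) ^ 2 + I * x * ξ) / (n + 1 : ℕ)) ^ n := by
  have hnR : (0 : ℝ) < n := by exact_mod_cast hn
  have hn0 : (n : ℂ) ≠ 0 := by exact_mod_cast hn.ne'
  have hn1 : (n : ℂ) + 1 ≠ 0 := by exact_mod_cast n.succ_ne_zero
  have hq0 : 0 < q := by rw [hq]; positivity
  have hK : √q * √((n + 1 : ℕ) : ℝ) = √(n : ℝ) := by
    rw [← Real.sqrt_mul hq0.le, hq]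
    congr 1
    push_cast
    field_simp
  have hs : ((√q : ℝ) : ℂ) ^ 2 = n / (n + 1) := by
    rw [← Complex.ofReal_pow, Real.sq_sqrt hq0.le, hq]; simp
  have key := intervalIntegral.smul_integral_comp_mul_left (a := -√((n + 1 : ℕ) : ℝ))
    (b := √((n + 1 : ℕ) : ℝ))
    (fun x : ℝ => (1 + (-(x : ℂ) ^ 2 + I * x * ((√q * ξ : ℝ) : ℂ)) / n) ^ n) √q
  rw [mul_neg, hK] at key
  rw [← key, Complex.real_smul]
  congr 1
  refine intervalIntegral.integral_congr fun x _ => ?_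
  have h : -((√q * x : ℝ) : ℂ) ^ 2 + I * ((√q * x : ℝ) : ℂ) * ((√q * ξ : ℝ) : ℂ) =
      ((√q : ℝ) : ℂ) ^ 2 * (-(x : ℂ) ^ 2 + I * x * ξ) := by
    push_cast; ring
  simp only [h, hs]
  congr 2
  push_cast
  field_simp

/-- for `q = (2m-1)/(2m)`, `Y(q,·)` is a polynomial of degree `2m`
(in particular differentiable) and satisfies the homogeneous equation
`2√q ∂_ξ Y(q,ξ) + ξ Y(2 - 1/q, √q ξ) = 0`, where `2 - 1/q = (2m-2)/(2m-1)`. -/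
theorem Yfun_fde_odd_case (m : ℕ) (hm : 0 < m) (q : ℝ)
    (hq : q = (2 * (m : ℝ) - 1) / (2 * (m : ℝ))) :
    (2 - 1 / q = (2 * (m : ℝ) - 2) / (2 * (m : ℝ) - 1)) ∧
    (∃ P : Polynomial ℂ, P.natDegree = 2 * m ∧ ∀ ξ : ℝ, Yfun q ξ = P.eval (ξ : ℂ)) ∧
    Differentiable ℝ (Yfun q) ∧
    ∀ ξ : ℝ, ((2 * Real.sqrt q : ℝ) : ℂ) * deriv (Yfun q) ξ +
      (ξ : ℂ) * Yfun (2 - 1 / q) (Real.sqrt q * ξ) = 0 := by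
  have hmR : (1 : ℝ) ≤ m := by exact_mod_cast hm
  have h2m : (0 : ℝ) < 2 * m - 1 := by linarith
  have hq' : 2 - 1 / q = (2 * (m : ℝ) - 2) / (2 * (m : ℝ) - 1) := by
    rw [hq]; field_simp; ring
  obtain ⟨n, hn⟩ : ∃ n : ℕ, 2 * m = n + 1 := ⟨2 * m - 1, by omega⟩
  have hn0 : 0 < n := by omega
  have hnm : 2 * (m : ℝ) = n + 1 := by exact_mod_cast hn
  have hev : Even (n + 1) := hn ▸ even_two_mul m
  have hY : Yfun q = fun ξ : ℝ => ∫ x in (-√((n + 1 : ℕ) : ℝ))..√((n + 1 : ℕ) : ℝ),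
      ((1 - (x : ℂ) ^ 2 / (n + 1 : ℕ)) + I * x / (n + 1 : ℕ) * ξ) ^ (n + 1) := by
    funext ξ
    rw [Yfun_eq_intervalIntegral n.succ_pos (by rw [hq, hnm]; push_cast; field_simp; ring)]
    refine intervalIntegral.integral_congr fun x _ => ?_
    congr 1
    ring
  have hY' : ∀ ξ, Yfun (2 - 1 / q) ξ = ∫ x in (-√(n : ℝ))..√(n : ℝ),
      (1 + (-(x : ℂ) ^ 2 + I * x * ξ) / n) ^ n := fun ξ => by
    refine Yfun_eq_intervalIntegral hn0 ?_ ξ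
    have : (0 : ℝ) < n := by exact_mod_cast hn0
    rw [hq', hnm, add_sub_cancel_right]
    field_simp
    ring
  have hderiv : ∀ ξ : ℝ, HasDerivAt (Yfun q) (∫ x in (-√((n + 1 : ℕ) : ℝ))..√((n + 1 : ℕ) : ℝ),
      ((n + 1 : ℕ) : ℂ) * ((1 - (x : ℂ) ^ 2 / (n + 1 : ℕ)) + I * x / (n + 1 : ℕ) * ξ) ^ n *
        (I * x / (n + 1 : ℕ))) ξ := fun ξ => by
    rw [hY]
    exact hasDerivAt_intervalIntegral_add_mul_pow (fun x : ℝ => 1 - (x : ℂ) ^ 2 / (n + 1 : ℕ))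
      (fun x : ℝ => I * x / (n + 1 : ℕ)) (by fun_prop) (by fun_prop) _ _ (n + 1) ξ
  refine ⟨hq', ?_, fun ξ => (hderiv ξ).differentiableAt, fun ξ => ?_⟩
  · obtain ⟨P, hdeg, hP⟩ := exists_polynomial_intervalIntegral_add_mul_pow
      (fun x : ℝ => 1 - (x : ℂ) ^ 2 / (n + 1 : ℕ)) (fun x : ℝ => I * x / (n + 1 : ℕ))
      (by fun_prop) (by fun_prop) (-√((n + 1 : ℕ) : ℝ)) √((n + 1 : ℕ) : ℝ) (n + 1)
      (integral_pow_symm_ne_zero n.succ_pos hev (by positivity))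
    exact ⟨P, hdeg.trans hn.symm, fun ξ => by rw [hY]; exact hP ξ⟩
  · have hparts := integral_deriv_pow_eq_zero n.succ_pos hev ξ
    rw [(hderiv ξ).deriv, hY', integral_rescale hn0 (by rw [hq, hnm]; ring)]
    set J := ∫ x in (-√((n + 1 : ℕ) : ℝ))..√((n + 1 : ℕ) : ℝ),
        (1 + (-(x : ℂ) ^ 2 + I * x * ξ) / (n + 1 : ℕ)) ^ n with hJ
    have hcomb : 2 * (∫ x in (-√((n + 1 : ℕ) : ℝ))..√((n + 1 : ℕ) : ℝ),
        ((n + 1 : ℕ) : ℂ) * ((1 - (x : ℂ) ^ 2 / (n + 1 : ℕ)) + I * x / (n + 1 : ℕ) * ξ) ^ n *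
          (I * x / (n + 1 : ℕ))) + ξ * J = 0 := by
      rw [hJ, ← intervalIntegral.integral_const_mul, ← intervalIntegral.integral_const_mul,
        ← intervalIntegral.integral_add (Continuous.intervalIntegrable (by fun_prop) _ _)
          (Continuous.intervalIntegrable (by fun_prop) _ _)]
      rw [← mul_zero (-I), ← hparts, ← intervalIntegral.integral_const_mul]
      refine intervalIntegral.integral_congr fun x _ => ?_
      have hne : ((n + 1 : ℕ) : ℂ) ≠ 0 := by exact_mod_cast n.succ_ne_zero
      have hb : (1 - (x : ℂ) ^ 2 / (n + 1 : ℕ)) + I * x / (n + 1 : ℕ) * ξ =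
          1 + (-(x : ℂ) ^ 2 + I * x * ξ) / (n + 1 : ℕ) := by ring
      simp only [hb, Nat.succ_eq_add_one, Nat.add_sub_cancel]
      generalize (1 + (-(x : ℂ) ^ 2 + I * x * ξ) / ((n + 1 : ℕ) : ℂ)) ^ n = w
      rw [mul_right_comm, mul_div_cancel₀ _ hne]
      linear_combination (w * ξ) * I_sq
    push_cast at hcomb ⊢
    linear_combination (√q : ℂ) * hcomb

end
end

section
/- Let 1 ≤ q < 3 and n ∈ ℕ_q (any n ∈ ℤ if q = 1), so that 1 ≤ q_n < 3. Define Φ_j(ξ) := C_{q_j}·e_{q_{j+1}}^{-(3 - q_j)·ξ²/8} for j ∈ {n, n−2}. Then Φ_n(0) = C_{q_n}, Φ_n is differentiable on ℝ, and 2√(q_n)·Φ_n'(ξ) + ξ·Φ_{n-2}(√(q_n)·ξ) = 0 for all ξ ∈ ℝ. In other words, Y(ξ) = C_{q_n}·e_{q_{n+1}}^{-(3 - q_n)·ξ²/8} solves the Cauchy problem 2√(q_n)·Y'(ξ) + ξ·Φ_{n-2}(√(q_n)·ξ) = 0, Y(0) = C_{q_n}, and this solution is a multiple of a q_{n+1}-Gaussian.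 -/
open MeasureTheory Complex Real Set Filter

noncomputable section

/-- The sequence `q_n = (2q - n(q-1))/(2 - n(q-1))`; `q_n = 1` for all `n` when `q = 1`. -/
def qseq (q : ℝ) (n : ℤ) : ℝ :=
  if q = 1 then 1 else (2 * q - n * (q - 1)) / (2 - n * (q - 1))

/-- The index set `ℕ_q`. -/
def Nq (q : ℝ) : Set ℤ :=
  if 1 < q then {n : ℤ | (n : ℝ) < 2 / (q - 1) - 1}
  else if q < 1 then {n : ℤ | -2 / (1 - q) < (n : ℝ)}
  else Set.univ

theorem qExpR_one_add_inv_neg {s w : ℝ} (hs : 0 < s) (hw : 0 ≤ w) :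
    qExpR (1 + 1 / s) (-w) = (1 + w / s) ^ (-s) := by
  have hq : 1 + 1 / s ≠ 1 := by
    have : 0 < 1 / s := by positivity
    linarith
  have hbase : 1 + (1 - (1 + 1 / s)) * -w = 1 + w / s := by ring
  have hexp : 1 / (1 - (1 + 1 / s)) = -s := by
    rw [show 1 - (1 + 1 / s) = -(1 / s) by ring, div_neg, one_div_one_div]
  have hpos : 0 < 1 + w / s := by positivity
  rw [qExpR, if_neg hq, hbase, if_neg hpos.not_ge, hexp]

theorem qExpR_gaussian_one_add_inv {s : ℝ} (hs : 1 / 2 < s) (ξ : ℝ) :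
    qExpR (1 + 1 / (s - 1 / 2)) (-(3 - (1 + 1 / s)) * ξ ^ 2 / 8) =
      (1 + ξ ^ 2 / (4 * s)) ^ (1 / 2 - s) := by
  have h0 : 0 < s := by linarith
  have h1 : 0 < s - 1 / 2 := by linarith
  have h2 : -(3 - (1 + 1 / s)) * ξ ^ 2 / 8 = -((s - 1 / 2) * (ξ ^ 2 / (4 * s))) := by
    field_simp
    ring
  rw [h2, qExpR_one_add_inv_neg h1 (by positivity), mul_div_cancel_left₀ _ h1.ne', neg_sub]

theorem integrable_one_add_sq_rpow_neg {s : ℝ} (hs : 1 / 2 < s) :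
    Integrable fun x : ℝ => (1 + x ^ 2) ^ (-s) := by
  have h := integrable_rpow_neg_one_add_norm_sq (E := ℝ) (μ := volume) (r := 2 * s)
    (by simp only [Module.finrank_self, Nat.cast_one]; linarith)
  refine h.congr (Eventually.of_forall fun x => ?_)
  simp only [Real.norm_eq_abs, sq_abs]
  congr 1
  ring

theorem abs_mul_one_add_sq_rpow_neg_le (s x : ℝ) :
    |x * (1 + x ^ 2) ^ (-s)| ≤ (1 + x ^ 2) ^ (-(s - 1 / 2)) := by
  have hpos : 0 < 1 + x ^ 2 := by positivity
  have hx : |x| ≤ (1 + x ^ 2) ^ (1 / 2 : ℝ) := by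
    rw [← Real.sqrt_eq_rpow]
    exact Real.abs_le_sqrt (by linarith)
  calc |x * (1 + x ^ 2) ^ (-s)| = |x| * (1 + x ^ 2) ^ (-s) := by
        rw [abs_mul, abs_of_pos (Real.rpow_pos_of_pos hpos _)]
    _ ≤ (1 + x ^ 2) ^ (1 / 2 : ℝ) * (1 + x ^ 2) ^ (-s) := by gcongr
    _ = (1 + x ^ 2) ^ (-(s - 1 / 2)) := by
        rw [← Real.rpow_add hpos]
        congr 1
        ring

theorem tendsto_mul_one_add_sq_rpow_neg {s : ℝ} (hs : 1 / 2 < s) {l : Filter ℝ}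
    (hl : Tendsto (fun x : ℝ => x ^ 2) l atTop) :
    Tendsto (fun x : ℝ => x * (1 + x ^ 2) ^ (-s)) l (nhds 0) :=
  squeeze_zero_norm (abs_mul_one_add_sq_rpow_neg_le s)
    ((tendsto_rpow_neg_atTop (sub_pos.2 hs)).comp (tendsto_atTop_add_const_left _ _ hl))

theorem integral_one_add_sq_rpow_neg_succ {s : ℝ} (hs : 1 / 2 < s) :
    ∫ x : ℝ, (1 + x ^ 2) ^ (-(s + 1)) =
      (s - 1 / 2) / s * ∫ x : ℝ, (1 + x ^ 2) ^ (-s) := by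
  have integrable_base := (integrable_one_add_sq_rpow_neg hs).const_mul (1 - 2 * s)
  have integrable_succ := (integrable_one_add_sq_rpow_neg (s := s + 1) (by linarith)).const_mul (2 * s)
  have hderiv : ∀ x : ℝ, HasDerivAt (fun x : ℝ => x * (1 + x ^ 2) ^ (-s))
      ((1 - 2 * s) * (1 + x ^ 2) ^ (-s) + 2 * s * (1 + x ^ 2) ^ (-(s + 1))) x := by
    intro x
    have hpos : 0 < 1 + x ^ 2 := by positivity
    have h := (hasDerivAt_id x).mul
      ((((hasDerivAt_id x).pow 2).const_add 1).rpow_const (p := -s) (Or.inl hpos.ne'))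
    refine h.congr_deriv ?_
    have hsplit : (1 + x ^ 2) ^ (-s) = (1 + x ^ 2) ^ (-(s + 1)) * (1 + x ^ 2) := by
      rw [← Real.rpow_add_one hpos.ne']
      congr 1
      ring
    simp only [Pi.pow_apply, id_eq, show -s - 1 = -(s + 1) by ring]
    rw [hsplit]
    push_cast
    ring
  have key := integral_of_hasDerivAt_of_tendsto hderiv (integrable_base.add integrable_succ)
    (tendsto_mul_one_add_sq_rpow_neg hs (by
      simpa [Function.comp_def] using!
        (tendsto_pow_atTop (α := ℝ) two_ne_zero).comp tendsto_neg_atBot_atTop))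
    (tendsto_mul_one_add_sq_rpow_neg hs (tendsto_pow_atTop two_ne_zero))
  rw [integral_add integrable_base integrable_succ, integral_const_mul, integral_const_mul] at key
  have h0 : s ≠ 0 := by linarith
  field_simp
  linarith

theorem Cq_one_add_inv {s : ℝ} (hs : 0 < s) :
    Cq (1 + 1 / s) = √s * ∫ x : ℝ, (1 + x ^ 2) ^ (-s) := by
  have h := Measure.integral_comp_div (fun x : ℝ => (1 + x ^ 2) ^ (-s)) √s
  rw [abs_of_nonneg (Real.sqrt_nonneg s), smul_eq_mul] at h
  rw [← h, Cq]
  congr 1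
  ext x
  rw [qExpR_one_add_inv_neg hs (sq_nonneg x), div_pow, Real.sq_sqrt hs.le]

/-- The recursion for the normalizing constants under `q ↦ q_{-2}`. -/
theorem Cq_one_add_inv_succ {s : ℝ} (hs : 1 / 2 < s) :
    Cq (1 + 1 / (s + 1)) = √(1 + 1 / s) * ((s - 1 / 2) / s) * Cq (1 + 1 / s) := by
  have h0 : 0 < s := by linarith
  have hsqrt : √(s + 1) = √(1 + 1 / s) * √s := by
    rw [← Real.sqrt_mul (by positivity)]
    congr 1
    field_simp
  rw [Cq_one_add_inv h0, Cq_one_add_inv (by linarith), integral_one_add_sq_rpow_neg_succ hs,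
    hsqrt]
  ring

theorem qseq_eq_one_add_inv {q : ℝ} (hq : 1 < q) {j : ℤ} {s : ℝ} (hs : 0 < s)
    (hj : s = 1 / (q - 1) - j / 2) : qseq q j = 1 + 1 / s := by
  have ha : q - 1 ≠ 0 := by linarith
  have hden : 2 - j * (q - 1) = 2 * (q - 1) * s := by
    rw [hj]
    field_simp
  have hnum : 2 * q - j * (q - 1) = 2 * (q - 1) * s + 2 * (q - 1) := by linarith
  rw [qseq, if_neg hq.ne', hden, hnum]
  field_simp

theorem hasDerivAt_one_add_sq_div_rpow {s : ℝ} (hs : 0 < s) (ξ : ℝ) :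
    HasDerivAt (fun ξ : ℝ => (1 + ξ ^ 2 / (4 * s)) ^ (1 / 2 - s))
      (ξ / (2 * s) * (1 / 2 - s) * (1 + ξ ^ 2 / (4 * s)) ^ (1 / 2 - (s + 1))) ξ := by
  have hpos : 0 < 1 + ξ ^ 2 / (4 * s) := by positivity
  have h := ((((hasDerivAt_id ξ).pow 2).div_const (4 * s)).const_add 1).rpow_const
    (p := 1 / 2 - s) (Or.inl hpos.ne')
  refine h.congr_deriv ?_
  simp only [Pi.pow_apply, id_eq, show 1 / 2 - s - 1 = 1 / 2 - (s + 1) by ring]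
  congr 2
  push_cast
  field_simp
  ring

theorem qExpR_zero (q : ℝ) : qExpR q 0 = 1 := by
  simp [qExpR]

/-- for `1 ≤ q < 3` and `n ∈ ℕ_q` one has `1 ≤ q_n < 3`, and the
function `Φ_n(ξ) = C_{q_n} e_{q_{n+1}}^{-(3-q_n)ξ²/8}` (a multiple of a
`q_{n+1}`-Gaussian) solves the Cauchy problem
`2√(q_n) Φ_n'(ξ) + ξ Φ_{n-2}(√(q_n) ξ) = 0`, `Φ_n(0) = C_{q_n}`. -/
theorem cauchy_problem_solution_of_one_le (q : ℝ) (hq1 : 1 ≤ q) (hq3 : q < 3)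
    (n : ℤ) (hn : n ∈ Nq q) :
    let Φ : ℤ → ℝ → ℝ := fun j ξ =>
      Cq (qseq q j) * qExpR (qseq q (j + 1)) (-(3 - qseq q j) * ξ ^ 2 / 8)
    (1 ≤ qseq q n ∧ qseq q n < 3) ∧
    Φ n 0 = Cq (qseq q n) ∧
    Differentiable ℝ (Φ n) ∧
    ∀ ξ : ℝ, 2 * Real.sqrt (qseq q n) * deriv (Φ n) ξ +
      ξ * Φ (n - 2) (Real.sqrt (qseq q n) * ξ) = 0 := by
  intro Φ
  have hzero : Φ n 0 = Cq (qseq q n) := by simp [Φ, qExpR_zero]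
  rcases hq1.eq_or_lt with rfl | hq
  · have hseq : ∀ j, qseq 1 j = 1 := fun j => if_pos rfl
    have hΦ : ∀ j, Φ j = fun ξ => Cq 1 * Real.exp (-(3 - 1) * ξ ^ 2 / 8) := by
      intro j
      simp only [Φ, hseq, qExpR, if_true]
    have hderiv : ∀ ξ, HasDerivAt (Φ n)
        (Cq 1 * (Real.exp (-(3 - 1) * ξ ^ 2 / 8) * (-ξ / 2))) ξ := by
      intro ξ
      rw [hΦ]
      have h := ((((hasDerivAt_id ξ).pow 2).const_mul (-(3 - 1) : ℝ)).div_const 8).exp.const_mul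
        (Cq 1)
      refine h.congr_deriv ?_
      simp only [Pi.pow_apply, id_eq]
      push_cast
      ring
    refine ⟨by norm_num [hseq], hzero, fun ξ => (hderiv ξ).differentiableAt, fun ξ => ?_⟩
    rw [(hderiv ξ).deriv, hΦ, hseq, Real.sqrt_one, one_mul]
    ring
  · obtain ⟨s, hs⟩ : ∃ s : ℝ, s = 1 / (q - 1) - n / 2 := ⟨_, rfl⟩
    have hs2 : 1 / 2 < s := by
      rw [Nq, if_pos hq, mem_ofPred_eq] at hn
      have : 2 / (q - 1) = 2 * (1 / (q - 1)) := by ring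
      linarith
    have h0 : 0 < s := by linarith
    have hn0 : qseq q n = 1 + 1 / s := qseq_eq_one_add_inv hq h0 hs
    have hn1 : qseq q (n + 1) = 1 + 1 / (s - 1 / 2) :=
      qseq_eq_one_add_inv hq (by linarith) (by rw [hs]; push_cast; ring)
    have hn2 : qseq q (n - 2) = 1 + 1 / (s + 1) :=
      qseq_eq_one_add_inv hq (by linarith) (by rw [hs]; push_cast; ring)
    have hn3 : qseq q (n - 2 + 1) = 1 + 1 / (s + 1 - 1 / 2) :=
      qseq_eq_one_add_inv hq (by linarith) (by rw [hs]; push_cast; ring)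
    have hΦn : Φ n = fun ξ => Cq (1 + 1 / s) * (1 + ξ ^ 2 / (4 * s)) ^ (1 / 2 - s) := by
      ext ξ
      simp only [Φ, hn0, hn1, qExpR_gaussian_one_add_inv hs2]
    have hΦn2 : ∀ ξ, Φ (n - 2) ξ =
        Cq (1 + 1 / (s + 1)) * (1 + ξ ^ 2 / (4 * (s + 1))) ^ (1 / 2 - (s + 1)) := by
      intro ξ
      simp only [Φ, hn2, hn3]
      rw [qExpR_gaussian_one_add_inv (by linarith)]
    have hderiv : ∀ ξ, HasDerivAt (Φ n) _ ξ := fun ξ =>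
      hΦn ▸ (hasDerivAt_one_add_sq_div_rpow h0 ξ).const_mul (Cq (1 + 1 / s))
    refine ⟨?_, hzero, fun ξ => (hderiv ξ).differentiableAt, fun ξ => ?_⟩
    · rw [hn0]
      have hpos : 0 < 1 / s := by positivity
      have hlt : 1 / s < 2 := by
        rw [div_lt_iff₀ h0]
        linarith
      constructor <;> linarith
    · have hbase : (√(1 + 1 / s) * ξ) ^ 2 / (4 * (s + 1)) = ξ ^ 2 / (4 * s) := by
        rw [mul_pow, Real.sq_sqrt (by positivity)]
        field_simp
      rw [(hderiv ξ).deriv, hΦn2, hn0, hbase, Cq_one_add_inv_succ hs2]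
      field_simp
      ring

end
end
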